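/- arXiv:2409.19547 — 3 statements merged into one kernel-verified Lean document; each statement's English description precedes it below -/
import Mathlib

section
/- For every integer n ≥ 0, the number of desarrangements of length n avoiding both patterns 123 and 312 equals the ceiling of (n − 1)²/4, i.e. d_n({123, 312}) = ⌈(n − 1)²/4⌉ (as an identity of integers, where (n − 1)² is computed in the integers). -/
open scoped Classical

/-- Index `i ∈ {1,…,n}` (1-indexed) is an ascent of the permutation `π` of length `n`,
written in one-line notation `π₁π₂⋯πₙ` with `πᵢ = π ⟨i-1, _⟩`: either `i = n`, or
`πᵢ < πᵢ₊₁`. -/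
def IsAscent (n : ℕ) (π : Equiv.Perm (Fin n)) (i : ℕ) : Prop :=
  1 ≤ i ∧ i ≤ n ∧ (i = n ∨ ∃ h : i < n, π ⟨i - 1, by omega⟩ < π ⟨i, h⟩)

/-- A permutation is a desarrangement if it is empty or its first (smallest) ascent is even. -/
def IsDesarrangement (n : ℕ) (π : Equiv.Perm (Fin n)) : Prop :=
  n = 0 ∨ ∃ i, IsAscent n π i ∧ Even i ∧ ∀ j, IsAscent n π j → i ≤ j

/-- `π` contains the pattern `σ` (where `σ` is given in 0-indexed one-line notation):
there are positions `i₁ < ⋯ < i_k` such that the letters of `π` at these positions are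
in the same relative order as the letters of `σ`. -/
def ContainsPattern {k n : ℕ} (σ : Fin k → Fin k) (π : Equiv.Perm (Fin n)) : Prop :=
  ∃ f : Fin k ↪o Fin n, ∀ a b : Fin k, π (f a) < π (f b) ↔ σ a < σ b

/-- `d_n(P)`: the number of desarrangements of length `n` avoiding every pattern in `P`
(patterns of length 3, in 0-indexed one-line notation). -/
noncomputable def dcount (n : ℕ) (P : Finset (Fin 3 → Fin 3)) : ℕ :=
  (Finset.univ.filter fun π : Equiv.Perm (Fin n) =>
    IsDesarrangement n π ∧ ∀ σ ∈ P, ¬ ContainsPattern σ π).card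

theorem containsPattern_of_triple {n : ℕ} {σ : Fin 3 → Fin 3} {π : Equiv.Perm (Fin n)}
    {a b c : Fin n} (hab : a < b) (hbc : b < c)
    (h : ∀ i j : Fin 3, π (![a, b, c] i) < π (![a, b, c] j) ↔ σ i < σ j) :
    ContainsPattern σ π := by
  have hmono : StrictMono ![a, b, c] := by
    intro i j hij
    have hac := hab.trans hbc
    fin_cases i <;> fin_cases j <;> simp_all
  exact ⟨OrderEmbedding.ofStrictMono _ hmono, h⟩

theorem containsPattern_123_iff {n : ℕ} {π : Equiv.Perm (Fin n)} :
    ContainsPattern ![0, 1, 2] π ↔ ∃ a b c, a < b ∧ b < c ∧ π a < π b ∧ π b < π c := by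
  constructor
  · rintro ⟨f, hf⟩
    exact ⟨f 0, f 1, f 2, f.strictMono (by decide), f.strictMono (by decide),
      (hf 0 1).2 (by decide), (hf 1 2).2 (by decide)⟩
  · rintro ⟨a, b, c, hab, hbc, h₁, h₂⟩
    refine containsPattern_of_triple hab hbc fun i j => ?_
    have h₃ := h₁.trans h₂
    fin_cases i <;> fin_cases j <;> simp [h₁, h₂, h₃, h₁.le, h₂.le, h₃.le]

theorem containsPattern_312_iff {n : ℕ} {π : Equiv.Perm (Fin n)} :
    ContainsPattern ![2, 0, 1] π ↔ ∃ a b c, a < b ∧ b < c ∧ π b < π c ∧ π c < π a := by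
  constructor
  · rintro ⟨f, hf⟩
    exact ⟨f 0, f 1, f 2, f.strictMono (by decide), f.strictMono (by decide),
      (hf 1 2).2 (by decide), (hf 2 0).2 (by decide)⟩
  · rintro ⟨a, b, c, hab, hbc, h₁, h₂⟩
    refine containsPattern_of_triple hab hbc fun i j => ?_
    have h₃ := h₁.trans h₂
    fin_cases i <;> fin_cases j <;> simp [h₁, h₂, h₃, h₁.le, h₂.le, h₃.le]

/-- The parameters `(k, m)` of a block word of length `n`. -/
def IsBlock (n k m : ℕ) : Prop :=
  2 ≤ k ∧ (m + k + 1 ≤ n ∨ (k = n ∧ m = 0))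

/-- The word that lists `m + k - 1, …, m` in decreasing order, then `n - 1`,
then the remaining letters in decreasing order. -/
def blockWord (n k m i : ℕ) : ℕ :=
  if i < k then m + k - 1 - i else if i = k then n - 1
  else if m ≤ n - 1 - i then n - 1 - i + k else n - 1 - i

theorem blockWord_lt {n k m i : ℕ} (h : IsBlock n k m) (hi : i < n) :
    blockWord n k m i < n := by
  unfold IsBlock at h
  unfold blockWord
  split_ifs <;> omega

theorem blockWord_inj {n k m i j : ℕ} (h : IsBlock n k m) (hi : i < n) (hj : j < n)
    (hij : blockWord n k m i = blockWord n k m j) : i = j := by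
  unfold IsBlock at h
  unfold blockWord at hij
  split_ifs at hij <;> omega

/-- The permutation whose one-line notation is `blockWord n k m`. -/
noncomputable def blockPerm {n k m : ℕ} (h : IsBlock n k m) : Equiv.Perm (Fin n) :=
  Equiv.ofBijective (fun i => ⟨blockWord n k m i, blockWord_lt h i.2⟩)
    (Finite.injective_iff_bijective.1 fun i j hij =>
      Fin.ext (blockWord_inj h i.2 j.2 (congrArg Fin.val hij)))

@[simp]
theorem val_blockPerm {n k m : ℕ} (h : IsBlock n k m) (i : Fin n) :
    (blockPerm h i : ℕ) = blockWord n k m i := rfl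

theorem isAscent_blockPerm {n k m : ℕ} (h : IsBlock n k m) : IsAscent n (blockPerm h) k := by
  have h' := h
  unfold IsBlock at h'
  refine ⟨by omega, by omega, ?_⟩
  rcases h'.2 with h₁ | h₁
  · refine Or.inr ⟨by omega, ?_⟩
    simp only [Fin.lt_def, val_blockPerm, blockWord]
    split_ifs <;> omega
  · exact Or.inl h₁.1

theorem le_of_isAscent_blockPerm {n k m j : ℕ} (h : IsBlock n k m)
    (hj : IsAscent n (blockPerm h) j) : k ≤ j := by
  have h' := h
  unfold IsBlock at h'
  obtain ⟨h₁, h₂, rfl | ⟨h₃, h₄⟩⟩ := hj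
  · omega
  · simp only [Fin.lt_def, val_blockPerm, blockWord] at h₄
    split_ifs at h₄ <;> omega

theorem blockPerm_avoids_123 {n k m : ℕ} (h : IsBlock n k m) :
    ¬ ContainsPattern ![0, 1, 2] (blockPerm h) := by
  rw [containsPattern_123_iff]
  rintro ⟨⟨a, ha⟩, ⟨b, hb⟩, ⟨c, hc⟩, hab, hbc, h₁, h₂⟩
  simp only [Fin.lt_def, val_blockPerm, blockWord] at *
  unfold IsBlock at h
  split_ifs at h₁ h₂ <;> omega

theorem blockPerm_avoids_312 {n k m : ℕ} (h : IsBlock n k m) :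
    ¬ ContainsPattern ![2, 0, 1] (blockPerm h) := by
  rw [containsPattern_312_iff]
  rintro ⟨⟨a, ha⟩, ⟨b, hb⟩, ⟨c, hc⟩, hab, hbc, h₁, h₂⟩
  simp only [Fin.lt_def, val_blockPerm, blockWord] at *
  unfold IsBlock at h
  split_ifs at h₁ h₂ <;> omega

/-- Two permutations that agree on an initial segment and are decreasing after it are equal. -/
theorem perm_eq_of_eqOn_of_decreasing {n k : ℕ} {π τ : Equiv.Perm (Fin n)}
    (heq : ∀ i : Fin n, (i : ℕ) ≤ k → π i = τ i)
    (hπ : ∀ i j : Fin n, k < (i : ℕ) → i < j → π j < π i)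
    (hτ : ∀ i j : Fin n, k < (i : ℕ) → i < j → τ j < τ i) : π = τ := by
  have hfix : ∀ i : Fin n, (i : ℕ) ≤ k → τ.symm (π i) = i := fun i hi => by simp [heq i hi]
  have hgt : ∀ i : Fin n, k < (i : ℕ) → k < (τ.symm (π i) : ℕ) := by
    intro i hi
    by_contra! hle
    have h := heq _ hle
    rw [Equiv.apply_symm_apply] at h
    rw [π.injective h] at hle
    omega
  have hmono : StrictMono fun i => τ.symm (π i) := by
    intro i j hij
    change τ.symm (π i) < τ.symm (π j)
    rcases le_or_gt (j : ℕ) k with hj | hj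
    · rwa [hfix i (by omega), hfix j hj]
    rcases le_or_gt (i : ℕ) k with hi | hi
    · rw [hfix i hi, Fin.lt_def]
      exact hi.trans_lt (hgt j hj)
    · by_contra! hle
      have hne : τ.symm (π j) ≠ τ.symm (π i) := fun h => hij.ne' (π.injective (τ.symm.injective h))
      have h := hτ _ _ (hgt j hj) (lt_of_le_of_ne hle hne)
      simp only [Equiv.apply_symm_apply] at h
      exact lt_asymm h (hπ i j hi hij)
  have hid := (hmono.range_inj strictMono_id).1 (by
    rw [Set.range_id]
    exact (π.trans τ.symm).surjective.range_eq)
  ext1 i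
  have h := congrFun hid i
  exact (Equiv.symm_apply_eq τ).1 h

theorem exists_eq_blockPerm {n k : ℕ} {π : Equiv.Perm (Fin n)} (hk : 2 ≤ k)
    (hasc : IsAscent n π k) (hmin : ∀ j, IsAscent n π j → k ≤ j)
    (h123 : ¬ ContainsPattern ![0, 1, 2] π) (h312 : ¬ ContainsPattern ![2, 0, 1] π) :
    ∃ (m : ℕ) (h : IsBlock n k m), π = blockPerm h := by
  rw [containsPattern_123_iff] at h123
  rw [containsPattern_312_iff] at h312
  push Not at h123 h312
  obtain ⟨-, hkn, hasc⟩ := hasc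
  have hstep : ∀ i (hi : i + 1 < k), π ⟨i + 1, by omega⟩ < π ⟨i, by omega⟩ := by
    intro i hi
    by_contra! hle
    have hlt := lt_of_le_of_ne hle fun h => by simpa using π.injective h
    have := hmin (i + 1) ⟨by omega, by omega, Or.inr ⟨by omega, hlt⟩⟩
    omega
  have hdec : ∀ i j (hij : i < j) (hj : j < k), π ⟨j, by omega⟩ < π ⟨i, by omega⟩ := by
    intro i j hij
    induction j, hij using Nat.le_induction with
    | base => exact fun hj => hstep i hj
    | succ j hij ih => exact fun hj => (hstep j hj).trans (ih (by omega))
  have hmax : ∀ (hlt : k < n) (i : Fin n), (i : ℕ) ≠ k → π i < π ⟨k, hlt⟩ := by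
    intro hlt i hi
    obtain ⟨hlt', hup⟩ := hasc.resolve_left hlt.ne
    have hne : π i ≠ π ⟨k, hlt⟩ := fun h => hi (congrArg Fin.val (π.injective h))
    refine lt_of_le_of_ne ?_ hne
    rcases lt_or_gt_of_ne hi with h | h
    · by_cases hi' : (i : ℕ) = k - 1
      · have : i = ⟨k - 1, by omega⟩ := Fin.ext hi'
        rw [this]
        exact hup.le
      · exact h312 i ⟨k - 1, by omega⟩ ⟨k, hlt⟩ (by simp [Fin.lt_def]; omega)
          (by simp [Fin.lt_def]; omega) hup
    · exact h123 ⟨k - 1, by omega⟩ ⟨k, hlt⟩ i (by simp [Fin.lt_def]; omega)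
          (by simpa [Fin.lt_def] using h) hup
  have htail : ∀ i j : Fin n, k < (i : ℕ) → i < j → π j < π i := by
    intro i j hi hij
    have hlt : k < n := hi.trans i.2
    by_contra! hle
    have hlt' := lt_of_le_of_ne hle (π.injective.ne hij.ne)
    have h₁ := h312 ⟨k, hlt⟩ i j hi hij hlt'
    exact absurd (hmax hlt j (by have := Fin.lt_def.1 hij; omega)) (not_lt.2 h₁)
  have hgap : ∀ i (hi : i + 1 < k),
      (π ⟨i, by omega⟩ : ℕ) = (π ⟨i + 1, by omega⟩ : ℕ) + 1 := by
    intro i hi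
    by_contra hne
    have hs := Fin.lt_def.1 (hstep i hi)
    have hb := (π ⟨i, by omega⟩).2
    obtain ⟨p, hp⟩ := π.surjective ⟨(π ⟨i + 1, by omega⟩ : ℕ) + 1, by omega⟩
    have hp' := congrArg Fin.val hp
    simp only at hp'
    have hpi : (p : ℕ) ≠ i := by rintro rfl; simp only [Fin.eta] at *; omega
    have hpi' : (p : ℕ) ≠ i + 1 := by
      intro h
      have : p = ⟨i + 1, by omega⟩ := Fin.ext h
      rw [this] at hp'
      omega
    rcases lt_or_ge (p : ℕ) k with hpk | hpk
    · rcases lt_or_ge (p : ℕ) i with h | h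
      · have := Fin.lt_def.1 (hdec p i h (by omega))
        simp only [Fin.eta] at this
        omega
      · have := Fin.lt_def.1 (hdec (i + 1) p (by omega) hpk)
        simp only [Fin.eta] at this
        omega
    · have hlt : k < n ∨ k = n := by omega
      rcases hlt with hlt | hlt
      · rcases eq_or_lt_of_le hpk with h | h
        · have := Fin.lt_def.1 (hmax hlt ⟨i, by omega⟩ (by simp; omega))
          have hpe : p = ⟨k, hlt⟩ := Fin.ext h.symm
          rw [← hpe] at this
          omega
        · have := h312 ⟨i, by omega⟩ ⟨i + 1, by omega⟩ p (by simp [Fin.lt_def])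
            (by simp [Fin.lt_def]; omega) (by rw [Fin.lt_def]; omega)
          rw [Fin.le_def] at this
          omega
      · have := p.2
        omega
  set m : ℕ := (π ⟨k - 1, by omega⟩ : Fin n).val
  have hval : ∀ d (hd : d < k), (π ⟨k - 1 - d, by omega⟩ : ℕ) = m + d := by
    intro d
    induction d with
    | zero => intro _; rfl
    | succ d ih =>
      intro hd
      have h₁ := hgap (k - 1 - (d + 1)) (by omega)
      have h₂ := ih (by omega)
      have h₃ : (⟨k - 1 - (d + 1) + 1, by omega⟩ : Fin n) = ⟨k - 1 - d, by omega⟩ :=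
        Fin.ext (by simp only; omega)
      rw [h₃, h₂] at h₁
      omega
  have hval' : ∀ i : Fin n, (i : ℕ) < k → (π i : ℕ) = m + k - 1 - i := by
    intro i hi
    have h₁ := hval (k - 1 - i) (by omega)
    have h₂ : (⟨k - 1 - (k - 1 - i), by omega⟩ : Fin n) = i := Fin.ext (by simp only; omega)
    rw [h₂] at h₁
    omega
  have hzero := hval' ⟨0, by omega⟩ (by simp only; omega)
  have hzero' := (π ⟨0, by omega⟩).2
  have htop : ∀ hlt : k < n, (π ⟨k, hlt⟩ : ℕ) = n - 1 := by
    intro hlt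
    obtain ⟨p, hp⟩ := π.surjective ⟨n - 1, by omega⟩
    have hp' := congrArg Fin.val hp
    simp only at hp'
    by_cases hpk : (p : ℕ) = k
    · have : p = ⟨k, hlt⟩ := Fin.ext hpk
      rwa [← this]
    · have := Fin.lt_def.1 (hmax hlt p hpk)
      have := (π ⟨k, hlt⟩).2
      omega
  have hblock : IsBlock n k m := by
    refine ⟨hk, ?_⟩
    rcases hkn.lt_or_eq with hlt | hlt
    · have h₁ := Fin.lt_def.1 (hmax hlt ⟨0, by omega⟩ (by simp only; omega))
      have h₂ := htop hlt
      simp only at hzero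
      omega
    · simp only at hzero
      omega
  refine ⟨m, hblock, perm_eq_of_eqOn_of_decreasing (k := k) ?_ htail ?_⟩
  · intro i hi
    apply Fin.ext
    rw [val_blockPerm, blockWord]
    rcases hi.lt_or_eq with h | h
    · rw [if_pos h, hval' i h]
    · have hlt : k < n := h ▸ i.2
      have hik : i = ⟨k, hlt⟩ := Fin.ext h
      rw [if_neg h.not_lt, if_pos h, ← htop hlt, hik]
  · intro i j hi hij
    have hj := j.2
    rw [Fin.lt_def] at hij ⊢
    rw [val_blockPerm, val_blockPerm, blockWord, blockWord]
    unfold IsBlock at hblock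
    split_ifs <;> omega

/-- The number of admissible `m` for the block length `k = 2 * (j + 1)`. -/
def blockCount (n j : ℕ) : ℕ :=
  if 2 * (j + 1) = n then 1 else n - 2 * (j + 1)

theorem isBlock_of_lt {n j m : ℕ} (hj : j < n / 2) (hm : m < blockCount n j) :
    IsBlock n (2 * (j + 1)) m := by
  unfold blockCount at hm
  unfold IsBlock
  split_ifs at hm <;> omega

theorem lt_of_isBlock {n j m : ℕ} (h : IsBlock n (2 * (j + 1)) m) :
    j < n / 2 ∧ m < blockCount n j := by
  unfold IsBlock at h
  unfold blockCount
  split_ifs <;> omega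

theorem eq_of_blockPerm_eq {n k m k' m' : ℕ} (h : IsBlock n k m) (h' : IsBlock n k' m')
    (heq : blockPerm h = blockPerm h') : k = k' ∧ m = m' := by
  have hk : k = k' := le_antisymm
    (le_of_isAscent_blockPerm h (heq ▸ isAscent_blockPerm h'))
    (le_of_isAscent_blockPerm h' (heq ▸ isAscent_blockPerm h))
  subst hk
  refine ⟨rfl, ?_⟩
  have hn : 0 < n := by unfold IsBlock at h; omega
  have h₀ := congrArg (fun π : Equiv.Perm (Fin n) => (π ⟨0, hn⟩ : ℕ)) heq
  simp only [val_blockPerm, blockWord] at h₀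
  unfold IsBlock at h
  split_ifs at h₀ <;> omega

theorem dcount_eq_sum {n : ℕ} (hn : n ≠ 0) :
    dcount n {![0, 1, 2], ![2, 0, 1]} = ∑ j ∈ Finset.range (n / 2), blockCount n j := by
  have hcard : ((Finset.range (n / 2)).sigma fun j => Finset.range (blockCount n j)).card =
      ∑ j ∈ Finset.range (n / 2), blockCount n j := by
    simp [Finset.card_sigma]
  rw [← hcard, dcount]
  symm
  refine Finset.card_bij (fun p hp => blockPerm (isBlock_of_lt (n := n) (j := p.1) (m := p.2)
    (Finset.mem_range.1 (Finset.mem_sigma.1 hp).1)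
    (Finset.mem_range.1 (Finset.mem_sigma.1 hp).2))) ?_ ?_ ?_
  · intro p hp
    simp only [Finset.mem_filter, Finset.mem_univ, true_and, Finset.mem_insert,
      Finset.mem_singleton, forall_eq_or_imp, forall_eq]
    exact ⟨Or.inr ⟨_, isAscent_blockPerm _, even_two_mul _,
      fun j hj => le_of_isAscent_blockPerm _ hj⟩, blockPerm_avoids_123 _, blockPerm_avoids_312 _⟩
  · rintro ⟨j, m⟩ hp ⟨j', m'⟩ hp' heq
    obtain ⟨h₁, rfl⟩ := eq_of_blockPerm_eq _ _ heq
    obtain rfl : j = j' := by simp only at h₁; omega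
    rfl
  · intro π hπ
    simp only [Finset.mem_filter, Finset.mem_univ, true_and, Finset.mem_insert,
      Finset.mem_singleton, forall_eq_or_imp, forall_eq] at hπ
    obtain ⟨hd, h123, h312⟩ := hπ
    obtain ⟨k, hasc, heven, hmin⟩ := hd.resolve_left hn
    obtain ⟨j, rfl⟩ : ∃ j, k = 2 * (j + 1) := by
      obtain ⟨r, hr⟩ := heven
      have := hasc.1
      exact ⟨r - 1, by omega⟩
    obtain ⟨m, h, rfl⟩ := exists_eq_blockPerm (by omega) hasc hmin h123 h312
    obtain ⟨hj, hm⟩ := lt_of_isBlock h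
    exact ⟨⟨j, m⟩, Finset.mem_sigma.2 ⟨Finset.mem_range.2 hj, Finset.mem_range.2 hm⟩, rfl⟩

theorem sum_blockCount_odd (t : ℕ) :
    ∑ j ∈ Finset.range t, blockCount (2 * t + 1) j = t ^ 2 := by
  induction t with
  | zero => simp
  | succ t ih =>
    have hs : ∀ j, blockCount (2 * (t + 1) + 1) (j + 1) = blockCount (2 * t + 1) j := by
      intro j
      unfold blockCount
      split_ifs <;> omega
    have h₀ : blockCount (2 * (t + 1) + 1) 0 = 2 * t + 1 := by
      unfold blockCount
      split_ifs <;> omega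
    rw [Finset.sum_range_succ', h₀]
    simp only [hs, ih]
    ring

theorem sum_blockCount_even (t : ℕ) :
    ∑ j ∈ Finset.range (t + 1), blockCount (2 * (t + 1)) j = t * (t + 1) + 1 := by
  induction t with
  | zero => simp [blockCount]
  | succ t ih =>
    have hs : ∀ j, blockCount (2 * (t + 1 + 1)) (j + 1) = blockCount (2 * (t + 1)) j := by
      intro j
      unfold blockCount
      split_ifs <;> omega
    have h₀ : blockCount (2 * (t + 1 + 1)) 0 = 2 * t + 2 := by
      unfold blockCount
      split_ifs <;> omega
    rw [Finset.sum_range_succ', h₀]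
    simp only [hs, ih]
    ring

theorem dcount_zero : dcount 0 {![0, 1, 2], ![2, 0, 1]} = 1 := by
  rw [dcount, Finset.filter_true_of_mem]
  · simp
  · intro π _
    exact ⟨Or.inl rfl, fun σ _ ⟨f, _⟩ => (f 0).elim0⟩

/-- For every integer `n ≥ 0`, `d_n({123, 312}) = ⌈(n − 1)²/4⌉`, where `(n − 1)²` is
computed in the integers. -/
theorem desarrangements_avoiding_123_312 (n : ℕ) :
    (dcount n {![0,1,2], ![2,0,1]} : ℤ) =
      ⌈((((n : ℤ) - 1) ^ 2 : ℤ) : ℚ) / 4⌉ := by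
  symm
  rcases Nat.eq_zero_or_pos n with rfl | hn
  · rw [dcount_zero, Int.ceil_eq_iff]
    norm_num
  rw [dcount_eq_sum hn.ne']
  rcases Nat.even_or_odd' n with ⟨t, rfl | rfl⟩
  · obtain ⟨s, rfl⟩ : ∃ s, t = s + 1 := ⟨t - 1, by omega⟩
    rw [Nat.mul_div_cancel_left _ two_pos, sum_blockCount_even, Int.ceil_eq_iff]
    push_cast
    constructor <;> linarith
  · rw [show (2 * t + 1) / 2 = t by omega, sum_blockCount_odd, Int.ceil_eq_iff]
    push_cast
    constructor <;> linarith
end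

section
/- For every integer n ≥ 1, the number of desarrangements of length n avoiding all three patterns 123, 132, and 231 equals n − 1 if n is odd and equals 1 if n is even. -/
open scoped Classical

/-- The permutation of length `m + 1` whose last letter is `v` and whose other letters appear in
decreasing order. -/
noncomputable def decreasingThenLast {m : ℕ} (v : Fin (m + 1)) : Equiv.Perm (Fin (m + 1)) :=
  Equiv.ofBijective (Fin.snoc (α := fun _ => Fin (m + 1)) (fun i => v.succAbove i.rev) v) <| by
    rw [← Finite.injective_iff_bijective, Fin.snoc_injective_iff]
    exact ⟨Fin.succAbove_right_injective.comp Fin.rev_injective,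
      fun ⟨i, hi⟩ => Fin.succAbove_ne v _ hi⟩

@[simp]
lemma decreasingThenLast_last {m : ℕ} (v : Fin (m + 1)) :
    decreasingThenLast v (Fin.last m) = v := by
  simp [decreasingThenLast]

@[simp]
lemma decreasingThenLast_castSucc {m : ℕ} (v : Fin (m + 1)) (i : Fin m) :
    decreasingThenLast v i.castSucc = v.succAbove i.rev := by
  simp [decreasingThenLast]

lemma decreasingThenLast_injective {m : ℕ} :
    Function.Injective (decreasingThenLast (m := m)) := fun v w h => by
  simpa using congrArg (fun π => π (Fin.last m)) h

/-- A permutation whose letters other than the last one decrease is determined by its last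
letter. -/
lemma strictAnti_castSucc_iff {m : ℕ} (π : Equiv.Perm (Fin (m + 1))) :
    StrictAnti (fun i : Fin m => π i.castSucc) ↔ ∃ v, decreasingThenLast v = π := by
  constructor
  · intro h
    refine ⟨π (Fin.last m), ?_⟩
    have hmono : StrictMono (fun i : Fin m => π i.rev.castSucc) :=
      fun i j hij => h (Fin.rev_lt_rev.2 hij)
    have hrange : Set.range (fun i : Fin m => (π (Fin.last m)).succAbove i) =
        Set.range (fun i : Fin m => π i.rev.castSucc) := by
      rw [Fin.range_succAbove]
      ext x
      simp only [Set.mem_compl_iff, Set.mem_singleton_iff, Set.mem_range]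
      constructor
      · intro hx
        have hne : π.symm x ≠ Fin.last m := fun h' => hx (by rw [← h', π.apply_symm_apply])
        obtain ⟨i, hi⟩ := Fin.exists_castSucc_eq.2 hne
        exact ⟨i.rev, by simp [hi]⟩
      · rintro ⟨i, rfl⟩ h'
        exact (Fin.castSucc_lt_last _).ne (π.injective h')
    have heq := ((Fin.strictMono_succAbove _).range_inj hmono).1 hrange
    ext i : 1
    refine Fin.lastCases (by simp) (fun i => ?_) i
    simpa using congrFun heq i.rev
  · rintro ⟨v, rfl⟩ i j hij
    simpa using Fin.strictMono_succAbove v (Fin.rev_lt_rev.2 hij)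

lemma containsPattern_of_lt {n : ℕ} {σ : Fin 3 → Fin 3} {π : Equiv.Perm (Fin n)} {i j k : Fin n}
    (hij : i < j) (hjk : j < k)
    (h : ∀ a b : Fin 3, π (![i, j, k] a) < π (![i, j, k] b) ↔ σ a < σ b) :
    ContainsPattern σ π :=
  ⟨OrderEmbedding.ofStrictMono ![i, j, k] (by
    intro a b hab
    fin_cases a <;> fin_cases b <;> simp_all
    exact hij.trans hjk), h⟩

lemma avoids_iff_strictAnti {m : ℕ} (π : Equiv.Perm (Fin (m + 1))) :
    (∀ σ ∈ ({![0,1,2], ![0,2,1], ![1,2,0]} : Finset (Fin 3 → Fin 3)), ¬ ContainsPattern σ π) ↔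
      StrictAnti (fun i : Fin m => π i.castSucc) := by
  constructor
  · intro h i j hij
    by_contra hlt
    have hij' : i.castSucc < j.castSucc := hij
    have hjk := Fin.castSucc_lt_last j
    have h1 : π i.castSucc < π j.castSucc :=
      lt_of_le_of_ne (not_lt.1 hlt) (fun e => hij'.ne (π.injective e))
    have hjl : π j.castSucc ≠ π (Fin.last m) := fun e => hjk.ne (π.injective e)
    have hil : π i.castSucc ≠ π (Fin.last m) := fun e => (hij'.trans hjk).ne (π.injective e)
    rcases lt_or_gt_of_ne hjl with h2 | h2
    · refine h ![0,1,2] (by simp) (containsPattern_of_lt hij' hjk fun a b => ?_)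
      fin_cases a <;> fin_cases b <;> simp <;> order
    rcases lt_or_gt_of_ne hil with h3 | h3
    · refine h ![0,2,1] (by simp) (containsPattern_of_lt hij' hjk fun a b => ?_)
      fin_cases a <;> fin_cases b <;> simp <;> order
    · refine h ![1,2,0] (by simp) (containsPattern_of_lt hij' hjk fun a b => ?_)
      fin_cases a <;> fin_cases b <;> simp <;> order
  · rintro h σ hσ ⟨f, hf⟩
    have h01 : f 0 < f 1 := f.strictMono (by decide)
    have h12 : f 1 < f 2 := f.strictMono (by decide)
    have hσ01 : σ 0 < σ 1 := by
      simp only [Finset.mem_insert, Finset.mem_singleton] at hσ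
      rcases hσ with rfl | rfl | rfl <;> decide
    have hasc := (hf 0 1).2 hσ01
    obtain ⟨j, hj⟩ := Fin.exists_castSucc_eq.2 (h12.trans_le (Fin.le_last _)).ne
    obtain ⟨i, hi⟩ := Fin.exists_castSucc_eq.2 ((h01.trans h12).trans_le (Fin.le_last _)).ne
    rw [← hi, ← hj] at h01 hasc
    exact lt_asymm hasc (h (Fin.castSucc_lt_castSucc_iff.1 h01))

lemma isDesarrangement_iff_of_least {n i : ℕ} {π : Equiv.Perm (Fin n)} (hn : n ≠ 0)
    (hi : IsAscent n π i) (hleast : ∀ j, IsAscent n π j → i ≤ j) :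
    IsDesarrangement n π ↔ Even i := by
  refine ⟨?_, fun h => Or.inr ⟨i, hi, h, hleast⟩⟩
  rintro (h | ⟨j, hj, he, hl⟩)
  · exact absurd h hn
  · rwa [le_antisymm (hleast j hj) (hl i hi)]

lemma le_of_isAscent_decreasingThenLast {m : ℕ} {v : Fin (m + 1)} {j : ℕ}
    (hj : IsAscent (m + 1) (decreasingThenLast v) j) : m ≤ j := by
  obtain ⟨h1, -, rfl | ⟨h, hlt⟩⟩ := hj
  · omega
  · by_contra hjm
    have hlt' : (⟨j - 1, by omega⟩ : Fin m) < ⟨j, by omega⟩ := by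
      simp only [Fin.mk_lt_mk]
      omega
    exact lt_asymm hlt ((strictAnti_castSucc_iff _).2 ⟨v, rfl⟩ hlt')

lemma isAscent_decreasingThenLast {m : ℕ} (v : Fin (m + 2)) :
    IsAscent (m + 2) (decreasingThenLast v) (m + 1) ↔ v ≠ 0 := by
  have hl : (⟨m + 1, by omega⟩ : Fin (m + 2)) = Fin.last (m + 1) := rfl
  have hp : (⟨m + 1 - 1, by omega⟩ : Fin (m + 2)) = (Fin.last m).castSucc := rfl
  simp only [IsAscent, hl, hp, decreasingThenLast_last, decreasingThenLast_castSucc, Fin.rev_last]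
  rcases eq_or_ne v 0 with rfl | hv
  · simp
  · simp [Fin.succAbove_ne_zero_zero hv, Fin.pos_iff_ne_zero, hv]

lemma isDesarrangement_decreasingThenLast {m : ℕ} (v : Fin (m + 1)) :
    IsDesarrangement (m + 1) (decreasingThenLast v) ↔ (v = 0 ↔ Even (m + 1)) := by
  have htop : IsAscent (m + 1) (decreasingThenLast v) (m + 1) :=
    ⟨by omega, le_rfl, Or.inl rfl⟩
  by_cases hv : v = 0
  · subst hv
    rw [isDesarrangement_iff_of_least (by omega) htop]
    · simp
    · intro j hj
      refine Nat.lt_of_le_of_ne (le_of_isAscent_decreasingThenLast hj) ?_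
      rintro rfl
      cases m with
      | zero => exact absurd hj.1 (by omega)
      | succ m => exact (isAscent_decreasingThenLast 0).1 hj rfl
  · cases m with
    | zero => exact absurd (Fin.fin_one_eq_zero v) hv
    | succ m =>
      rw [isDesarrangement_iff_of_least (by omega) ((isAscent_decreasingThenLast v).2 hv)
        fun j hj => le_of_isAscent_decreasingThenLast hj]
      simp [hv, Nat.even_add_one (n := m + 1)]

/-- For every integer `n ≥ 1`, `d_n({123, 132, 231})` equals `n − 1` if `n` is odd and
equals `1` if `n` is even. -/
theorem desarrangements_avoiding_123_132_231 (n : ℕ) (hn : 1 ≤ n) :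
    dcount n {![0,1,2], ![0,2,1], ![1,2,0]} = if Odd n then n - 1 else 1 := by
  obtain ⟨m, rfl⟩ : ∃ m, n = m + 1 := ⟨n - 1, by omega⟩
  have hset : (Finset.univ.filter fun π : Equiv.Perm (Fin (m + 1)) =>
      IsDesarrangement (m + 1) π ∧
        ∀ σ ∈ ({![0,1,2], ![0,2,1], ![1,2,0]} : Finset (Fin 3 → Fin 3)), ¬ ContainsPattern σ π) =
      (Finset.univ.filter fun v : Fin (m + 1) => (v = 0 ↔ Even (m + 1))).map
        ⟨decreasingThenLast, decreasingThenLast_injective⟩ := by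
    ext π
    simp only [Finset.mem_filter, Finset.mem_univ, true_and, avoids_iff_strictAnti,
      strictAnti_castSucc_iff, Finset.mem_map, Function.Embedding.coeFn_mk]
    constructor
    · rintro ⟨hd, v, rfl⟩
      exact ⟨v, (isDesarrangement_decreasingThenLast v).1 hd, rfl⟩
    · rintro ⟨v, hv, rfl⟩
      exact ⟨(isDesarrangement_decreasingThenLast v).2 hv, v, rfl⟩
  have hcard : dcount (m + 1) {![0,1,2], ![0,2,1], ![1,2,0]} =
      (Finset.univ.filter fun v : Fin (m + 1) => (v = 0 ↔ Even (m + 1))).card := by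
    rw [← Finset.card_map ⟨decreasingThenLast, decreasingThenLast_injective⟩, ← hset]
    unfold dcount
    congr!
  rw [hcard]
  split_ifs with ho
  · simp [Nat.not_even_iff_odd.2 ho, Finset.filter_ne']
  · simp [Nat.not_odd_iff_even.1 ho, Finset.filter_eq']
end

section
/- For every integer n ≥ 1 and each pattern σ ∈ {132, 231}, the number of desarrangements of length n avoiding all three patterns 123, 312, and σ equals ⌊n/2⌋, i.e. d_n({123, 312, σ}) = ⌊n/2⌋. -/
open scoped Classical

theorem containsPattern_three_iff {n : ℕ} (σ : Fin 3 → Fin 3) (π : Equiv.Perm (Fin n)) :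
    ContainsPattern σ π ↔ ∃ a b c : Fin n, a < b ∧ b < c ∧
      ∀ x y : Fin 3, π (![a, b, c] x) < π (![a, b, c] y) ↔ σ x < σ y := by
  constructor
  · rintro ⟨f, hf⟩
    refine ⟨f 0, f 1, f 2, f.strictMono (by decide), f.strictMono (by decide), ?_⟩
    have h : ![f 0, f 1, f 2] = f := by
      ext i
      fin_cases i <;> rfl
    simpa only [h] using hf
  · rintro ⟨a, b, c, hab, hbc, h⟩
    have hm : StrictMono ![a, b, c] := by
      rw [Fin.strictMono_iff_lt_succ]
      intro i
      fin_cases i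
      · exact hab
      · exact hbc
    exact ⟨OrderEmbedding.ofStrictMono _ hm, h⟩

theorem containsPattern_012_iff {n : ℕ} (π : Equiv.Perm (Fin n)) :
    ContainsPattern ![0, 1, 2] π ↔ ∃ a b c, a < b ∧ b < c ∧ π a < π b ∧ π b < π c := by
  rw [containsPattern_three_iff]
  refine exists_congr fun a => exists_congr fun b => exists_congr fun c =>
    and_congr_right fun _ => and_congr_right fun _ => ?_
  simp [Fin.forall_fin_succ]
  grind

theorem containsPattern_201_iff {n : ℕ} (π : Equiv.Perm (Fin n)) :
    ContainsPattern ![2, 0, 1] π ↔ ∃ a b c, a < b ∧ b < c ∧ π b < π c ∧ π c < π a := by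
  rw [containsPattern_three_iff]
  refine exists_congr fun a => exists_congr fun b => exists_congr fun c =>
    and_congr_right fun _ => and_congr_right fun _ => ?_
  simp [Fin.forall_fin_succ]
  grind

theorem containsPattern_021_iff {n : ℕ} (π : Equiv.Perm (Fin n)) :
    ContainsPattern ![0, 2, 1] π ↔ ∃ a b c, a < b ∧ b < c ∧ π a < π c ∧ π c < π b := by
  rw [containsPattern_three_iff]
  refine exists_congr fun a => exists_congr fun b => exists_congr fun c =>
    and_congr_right fun _ => and_congr_right fun _ => ?_
  simp [Fin.forall_fin_succ]
  grind

theorem containsPattern_120_iff {n : ℕ} (π : Equiv.Perm (Fin n)) :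
    ContainsPattern ![1, 2, 0] π ↔ ∃ a b c, a < b ∧ b < c ∧ π c < π a ∧ π a < π b := by
  rw [containsPattern_three_iff]
  refine exists_congr fun a => exists_congr fun b => exists_congr fun c =>
    and_congr_right fun _ => and_congr_right fun _ => ?_
  simp [Fin.forall_fin_succ]
  grind

/-- A permutation is determined by its set of non-inversions. -/
theorem perm_eq_of_lt_iff_lt {n : ℕ} {π τ : Equiv.Perm (Fin n)}
    (h : ∀ i j, i < j → (π i < π j ↔ τ i < τ j)) : π = τ := by
  have hlt : ∀ i j, τ i < τ j → π i < π j := by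
    intro i j hij
    rcases lt_trichotomy i j with hlt | rfl | hgt
    · exact (h i j hlt).2 hij
    · exact absurd hij (lt_irrefl _)
    · have h1 : ¬ π j < π i := fun hc => lt_asymm hij ((h j i hgt).1 hc)
      exact lt_of_le_of_ne (not_lt.1 h1) fun he => hgt.ne' (π.injective he)
  have hm : StrictMono (τ.symm.trans π) := fun x y hxy => hlt _ _ (by simpa using hxy)
  have hid : (τ.symm.trans π : Fin n → Fin n) = id :=
    (hm.range_inj strictMono_id).1 (by
      rw [Set.range_id, (τ.symm.trans π).surjective.range_eq])
  ext i
  have := congrFun hid (τ i)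
  simp at this
  rw [this]

/-- The set of ascents of a permutation has least element `k` exactly when the permutation
decreases on its first `k` positions and the `k`-th position is an ascent. -/
theorem isLeast_isAscent_iff {n : ℕ} (π : Equiv.Perm (Fin n)) (k : ℕ) :
    IsLeast {i | IsAscent n π i} k ↔ 1 ≤ k ∧ k ≤ n ∧
      (∀ i j : Fin n, i < j → j.val < k → π j < π i) ∧
      ∀ i j : Fin n, i.val + 1 = k → j.val = k → π i < π j := by
  constructor
  · rintro ⟨⟨h1, h2, h3⟩, hmin⟩
    refine ⟨h1, h2, ?_, ?_⟩
    · have hstep : ∀ i j : Fin n, i.val + 1 = j.val → j.val < k → π j < π i := by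
        intro i j hij hj
        by_contra hc
        have hne : π i ≠ π j := fun he => by
          have := π.injective he
          omega
        have hlt : π i < π j := lt_of_le_of_ne (not_lt.1 hc) hne
        have : k ≤ j.val := hmin ⟨by omega, by omega, Or.inr ⟨j.isLt, by
          have e : i = ⟨j - 1, by omega⟩ := Fin.ext (by dsimp only; omega)
          simpa only [e] using hlt⟩⟩
        omega
      have hall : ∀ d : ℕ, ∀ i j : Fin n, i.val + d + 1 = j.val → j.val < k → π j < π i := by
        intro d
        induction d with
        | zero => exact fun i j hij hj => hstep i j (by omega) hj
        | succ d ih =>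
          intro i j hij hj
          exact (hstep ⟨i + d + 1, by omega⟩ j (by simp; omega) hj).trans
            (ih i ⟨i + d + 1, by omega⟩ rfl (by simp; omega))
      intro i j hij hj
      exact hall (j - i - 1) i j (by omega) hj
    · intro i j hi hj
      rcases h3 with h3 | ⟨hk, h3⟩
      · omega
      · have e1 : i = ⟨k - 1, by omega⟩ := Fin.ext (by simp; omega)
        have e2 : j = ⟨k, hk⟩ := Fin.ext hj
        simpa only [e1, e2] using h3
  · rintro ⟨h1, h2, hdec, hasc⟩
    refine ⟨⟨h1, h2, ?_⟩, ?_⟩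
    · rcases h2.eq_or_lt with h | h
      · exact Or.inl h
      · exact Or.inr ⟨h, hasc _ _ (by simp; omega) rfl⟩
    · rintro j ⟨hj1, hj2, hj3⟩
      by_contra hc
      rcases hj3 with hj3 | ⟨hj, hj3⟩
      · omega
      · exact lt_asymm hj3 (hdec _ _ (by simp only [Fin.lt_def]; omega) (by simp; omega))

/-- If for each `k` the permutations of length `n` avoiding `P` with first ascent `k` reduce to
a single one, then half of the `P`-avoiding permutations are desarrangements. -/
theorem dcount_eq_half {n : ℕ} (hn : 1 ≤ n) (P : Finset (Fin 3 → Fin 3))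
    (τ : ℕ → Equiv.Perm (Fin n))
    (hτ : ∀ k, 1 ≤ k → k ≤ n → ∀ π : Equiv.Perm (Fin n),
      (IsLeast {i | IsAscent n π i} k ∧ ∀ σ ∈ P, ¬ ContainsPattern σ π) ↔ π = τ k) :
    dcount n P = n / 2 := by
  rw [← Nat.Ioc_filter_dvd_card_eq_div n 2, dcount]
  symm
  refine Finset.card_bij (fun k _ => τ k) ?_ ?_ ?_
  · intro k hk
    simp only [Finset.mem_filter, Finset.mem_Ioc, Finset.mem_univ, true_and] at hk ⊢
    obtain ⟨⟨hasc, hmin⟩, hP⟩ := (hτ k hk.1.1 hk.1.2 (τ k)).2 rfl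
    exact ⟨Or.inr ⟨k, hasc, even_iff_two_dvd.2 hk.2, fun j hj => hmin hj⟩, hP⟩
  · intro k hk l hl hkl
    simp only [Finset.mem_filter, Finset.mem_Ioc] at hk hl
    have h1 := ((hτ k hk.1.1 hk.1.2 (τ k)).2 rfl).1
    have h2 := ((hτ l hl.1.1 hl.1.2 (τ k)).2 hkl).1
    exact h1.unique h2
  · intro π hπ
    simp only [Finset.mem_filter, Finset.mem_univ, true_and] at hπ
    obtain ⟨h0 | ⟨k, hasc, hev, hmin⟩, hP⟩ := hπ
    · omega
    · refine ⟨k, ?_, ((hτ k hasc.1 hasc.2.1 π).1 ⟨⟨hasc, fun j hj => hmin j hj⟩, hP⟩).symm⟩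
      simp only [Finset.mem_filter, Finset.mem_Ioc]
      exact ⟨⟨hasc.1, hasc.2.1⟩, even_iff_two_dvd.1 hev⟩

/-- A permutation with first ascent `k` avoiding `123` and `312` decreases from position `k + 1`
on, and its entry there exceeds all earlier ones. -/
theorem decreasing_of_avoids_012_201 {n k : ℕ} {π : Equiv.Perm (Fin n)}
    (hk : IsLeast {i | IsAscent n π i} k)
    (h012 : ¬ ContainsPattern ![0, 1, 2] π) (h201 : ¬ ContainsPattern ![2, 0, 1] π) :
    (∀ i j : Fin n, i < j → k ≤ i.val → π j < π i) ∧
      ∀ i j : Fin n, i < j → j.val = k → π i < π j := by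
  rw [isLeast_isAscent_iff] at hk
  obtain ⟨h1, h2, hdec, hasc⟩ := hk
  rw [containsPattern_012_iff] at h012
  rw [containsPattern_201_iff] at h201
  push Not at h012 h201
  have hne : ∀ i j : Fin n, i < j → π i ≠ π j := fun i j h he => h.ne (π.injective he)
  have hmax : ∀ i j : Fin n, i.val = k → i < j → π j < π i := by
    intro i j hi hij
    have hlt : (⟨k - 1, by omega⟩ : Fin n) < i := by simp only [Fin.lt_def]; omega
    exact lt_of_le_of_ne (h012 _ i j hlt hij (hasc _ _ (by simp; omega) hi)) (hne _ _ hij).symm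
  refine ⟨?_, ?_⟩
  · intro i j hij hki
    rcases hki.eq_or_lt with hki | hki
    · exact hmax i j hki.symm hij
    · by_contra hc
      have hkn : k < n := hki.trans i.isLt
      have hlt : π i < π j := lt_of_le_of_ne (not_lt.1 hc) (hne _ _ hij)
      exact absurd (h201 ⟨k, hkn⟩ i j hki hij hlt)
        (not_le.2 (hmax ⟨k, hkn⟩ j rfl (Fin.lt_def.2 (hki.trans hij))))
  · intro i j hij hj
    have hj' : π ⟨k - 1, by omega⟩ < π j := hasc _ _ (by simp; omega) hj
    by_cases hi : i.val = k - 1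
    · rwa [show i = ⟨k - 1, by omega⟩ from Fin.ext hi]
    · exact lt_of_le_of_ne (h201 i ⟨k - 1, by omega⟩ j (by simp only [Fin.lt_def]; omega)
        (by simp only [Fin.lt_def]; omega) hj') (hne _ _ hij)

/-- The permutation `(n-1) ⋯ (n-k) n (n-k-1) ⋯ 1` in one-line notation. -/
noncomputable def insertMaxPerm (n k : ℕ) : Equiv.Perm (Fin n) :=
  Equiv.ofBijective
    (fun i : Fin n => if n ≤ k then ⟨n - 1 - i, by omega⟩
      else if i.val < k then ⟨n - 2 - i, by omega⟩
      else if i.val = k then ⟨n - 1, by have := i.isLt; omega⟩ else ⟨n - 1 - i, by omega⟩)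
    (Finite.injective_iff_bijective.1 fun i j h => by
      apply Fin.ext
      split_ifs at h <;> simp only [Fin.mk.injEq] at h <;> omega)

/-- The permutation `k ⋯ 1 n ⋯ (k+1)` in one-line notation. -/
noncomputable def twoLayerPerm (n k : ℕ) : Equiv.Perm (Fin n) :=
  Equiv.ofBijective
    (fun i : Fin n => if i.val < k then ⟨min k n - 1 - i, by omega⟩
      else ⟨n - 1 - (i - k), by omega⟩)
    (Finite.injective_iff_bijective.1 fun i j h => by
      apply Fin.ext
      split_ifs at h <;> simp only [Fin.mk.injEq] at h <;> omega)

theorem insertMaxPerm_lt_iff {n k : ℕ} (hk : k ≤ n) {i j : Fin n} (hij : i < j) :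
    insertMaxPerm n k i < insertMaxPerm n k j ↔ j.val = k := by
  rw [Fin.lt_def] at hij
  simp only [insertMaxPerm, Equiv.ofBijective_apply]
  split_ifs <;> simp only [Fin.mk_lt_mk] <;> omega

theorem twoLayerPerm_lt_iff {n k : ℕ} (hk : k ≤ n) {i j : Fin n} (hij : i < j) :
    twoLayerPerm n k i < twoLayerPerm n k j ↔ i.val < k ∧ k ≤ j.val := by
  rw [Fin.lt_def] at hij
  simp only [twoLayerPerm, Equiv.ofBijective_apply]
  split_ifs <;> simp only [Fin.mk_lt_mk] <;> omega

theorem avoids_021_iff_eq_insertMaxPerm {n k : ℕ} (h1 : 1 ≤ k) (hk : k ≤ n)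
    (π : Equiv.Perm (Fin n)) :
    (IsLeast {i | IsAscent n π i} k ∧
      ∀ σ ∈ ({![0, 1, 2], ![2, 0, 1], ![0, 2, 1]} : Finset (Fin 3 → Fin 3)),
        ¬ ContainsPattern σ π) ↔ π = insertMaxPerm n k := by
  simp only [Finset.mem_insert, Finset.mem_singleton, forall_eq_or_imp, forall_eq]
  constructor
  · rintro ⟨hl, h012, h201, h021⟩
    obtain ⟨hd, hm⟩ := decreasing_of_avoids_012_201 hl h012 h201
    obtain ⟨-, -, hdec, -⟩ := (isLeast_isAscent_iff π k).1 hl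
    rw [containsPattern_021_iff] at h021
    push Not at h021
    refine perm_eq_of_lt_iff_lt fun i j hij => ?_
    rw [insertMaxPerm_lt_iff hk hij]
    refine ⟨fun h => ?_, hm i j hij⟩
    by_contra hj
    rcases lt_or_gt_of_ne hj with hj | hj
    · exact lt_asymm h (hdec i j hij hj)
    · by_cases hi : k ≤ i.val
      · exact lt_asymm h (hd i j hij hi)
      · have hkn : k < n := hj.trans j.isLt
        exact absurd (h021 i ⟨k, hkn⟩ j (Fin.lt_def.2 (not_le.1 hi)) hj h)
          (not_le.2 (hd ⟨k, hkn⟩ j hj le_rfl))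
  · rintro rfl
    have key := fun (i j : Fin n) (hij : i < j) => insertMaxPerm_lt_iff hk hij
    have inj := (insertMaxPerm n k).injective
    rw [isLeast_isAscent_iff, containsPattern_012_iff, containsPattern_201_iff,
      containsPattern_021_iff]
    refine ⟨⟨h1, hk, ?_, ?_⟩, ?_, ?_, ?_⟩
    · intro i j hij hj
      have := key i j hij
      have := inj.ne hij.ne
      omega
    · intro i j hi hj
      have := key i j (by omega)
      omega
    all_goals
      rintro ⟨a, b, c, hab, hbc, hx, hy⟩
      have := key a b hab
      have := key b c hbc
      have := key a c (hab.trans hbc)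
      omega

theorem avoids_120_iff_eq_twoLayerPerm {n k : ℕ} (h1 : 1 ≤ k) (hk : k ≤ n)
    (π : Equiv.Perm (Fin n)) :
    (IsLeast {i | IsAscent n π i} k ∧
      ∀ σ ∈ ({![0, 1, 2], ![2, 0, 1], ![1, 2, 0]} : Finset (Fin 3 → Fin 3)),
        ¬ ContainsPattern σ π) ↔ π = twoLayerPerm n k := by
  simp only [Finset.mem_insert, Finset.mem_singleton, forall_eq_or_imp, forall_eq]
  constructor
  · rintro ⟨hl, h012, h201, h120⟩
    obtain ⟨hd, hm⟩ := decreasing_of_avoids_012_201 hl h012 h201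
    obtain ⟨-, -, hdec, -⟩ := (isLeast_isAscent_iff π k).1 hl
    rw [containsPattern_120_iff] at h120
    push Not at h120
    refine perm_eq_of_lt_iff_lt fun i j hij => ?_
    rw [twoLayerPerm_lt_iff hk hij]
    refine ⟨fun h => ⟨?_, ?_⟩, fun ⟨hi, hj⟩ => ?_⟩
    · by_contra hi
      exact lt_asymm h (hd i j hij (not_lt.1 hi))
    · by_contra hj
      exact lt_asymm h (hdec i j hij (not_le.1 hj))
    · rcases hj.eq_or_lt with hj | hj
      · exact hm i j hij hj.symm
      · have hkn : k < n := hj.trans j.isLt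
        by_contra hc
        have hlt : π j < π i := lt_of_le_of_ne (not_lt.1 hc) fun he => hij.ne' (π.injective he)
        exact absurd (h120 i ⟨k, hkn⟩ j hi hj hlt) (not_le.2 (hm i ⟨k, hkn⟩ hi rfl))
  · rintro rfl
    have key := fun (i j : Fin n) (hij : i < j) => twoLayerPerm_lt_iff hk hij
    have inj := (twoLayerPerm n k).injective
    rw [isLeast_isAscent_iff, containsPattern_012_iff, containsPattern_201_iff,
      containsPattern_120_iff]
    refine ⟨⟨h1, hk, ?_, ?_⟩, ?_, ?_, ?_⟩
    · intro i j hij hj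
      have := key i j hij
      have := inj.ne hij.ne
      omega
    · intro i j hi hj
      have := key i j (by omega)
      omega
    all_goals
      rintro ⟨a, b, c, hab, hbc, hx, hy⟩
      have := key a b hab
      have := key b c hbc
      have := key a c (hab.trans hbc)
      omega

/-- For every integer `n ≥ 1` and each `σ ∈ {132, 231}`,
`d_n({123, 312, σ}) = ⌊n/2⌋`. -/
theorem desarrangements_avoiding_123_312_and_friend (n : ℕ) (hn : 1 ≤ n)
    (σ : Fin 3 → Fin 3) (hσ : σ = ![0,2,1] ∨ σ = ![1,2,0]) :
    dcount n {![0,1,2], ![2,0,1], σ} = n / 2 := by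
  rcases hσ with rfl | rfl
  · exact dcount_eq_half hn _ (insertMaxPerm n) fun _ => avoids_021_iff_eq_insertMaxPerm
  · exact dcount_eq_half hn _ (twoLayerPerm n) fun _ => avoids_120_iff_eq_twoLayerPerm
end
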